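/- Let m, n ≥ 4. The concatenation L'_m(a,b) · L_n(a,-,b) has state complexity exactly (m-1)·2^{n-1} + 1, where L'_m(a,b) is over alphabet {a,b} on states Q'_m, and L_n(a,-,b) is over alphabet {a,b} with b inducing the transformation originally induced by c. -/

import Mathlib

/-- Left quotient of a language by a word. -/
def leftQuot {α : Type} (L : Set (List α)) (w : List α) : Set (List α) := {x | w ++ x ∈ L}

/-- The set of left quotients of `L`. -/
def quotients {α : Type} (L : Set (List α)) : Set (Set (List α)) :=
  Set.range (leftQuot L)

/-- The state complexity of `L`: the number of distinct left quotients of `L`. -/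
noncomputable def stateComplexity {α : Type} (L : Set (List α)) : ℕ :=
  Nat.card (quotients L)

/-- Concatenation (product) of two languages. -/
def concat {α : Type} (L1 L2 : Set (List α)) : Set (List α) :=
  {w | ∃ u v, u ∈ L1 ∧ v ∈ L2 ∧ w = u ++ v}

/-- The two-letter alphabet `{a,b}`. -/
inductive AB : Type
  | a | b
  deriving DecidableEq

/-- The transitions of `D'_m(a,b)` (states `{0,…,m-1}` embedded in `ℕ`):
`a : (1,…,m-1)(0→1)`, `b : (1,2)(0→2)`. -/
def stepAB (m : ℕ) (q : ℕ) : AB → ℕ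
  | AB.a => if q = m - 1 then 1 else q + 1
  | AB.b => if q = 0 then 2 else if q = 1 then 2 else if q = 2 then 1 else q

/-- The DFA `D'_m(a,b)`, initial state `0`, final state `m-1`. -/
def DmAB (m : ℕ) : DFA AB ℕ := ⟨stepAB m, 0, {m - 1}⟩

/-- The language `L'_m(a,b)`. -/
def LmAB (m : ℕ) : Set (List AB) := (DmAB m).accepts

/-- The transitions of the dialect `D_n(a,-,b)`: `a` is as usual and the letter `b`
induces the transformation of the original letter `c`, namely `(2,…,n-1)(1→2)(0→1)`. -/
def stepAC (n : ℕ) (q : ℕ) : AB → ℕ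
  | AB.a => if q = n - 1 then 1 else q + 1
  | AB.b => if q = n - 1 then 2 else q + 1

/-- The DFA `D_n(a,-,b)`, initial state `0`, final state `n-1`. -/
def DnAC (n : ℕ) : DFA AB ℕ := ⟨stepAC n, 0, {n - 1}⟩

/-- The language `L_n(a,-,b)`. -/
def LnAC (n : ℕ) : Set (List AB) := (DnAC n).accepts


/-- One step of the subset automaton of the product. The state `0` of the second automaton is
left implicit: it is present exactly when the first component is `m - 1`. -/
def stepR (m n : ℕ) (s : ℕ × Finset ℕ) (c : AB) : ℕ × Finset ℕ :=
  (stepAB m s.1 c, s.2.image (fun q => stepAC n q c) ∪ if s.1 = m - 1 then {1} else ∅)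

/-- Running the subset automaton. -/
def evR (m n : ℕ) (s : ℕ × Finset ℕ) (w : List AB) : ℕ × Finset ℕ := w.foldl (stepR m n) s

/-- The language of a state of the subset automaton. -/
def langR (m n : ℕ) (s : ℕ × Finset ℕ) : Set (List AB) := {x | n - 1 ∈ (evR m n s x).2}

/-- Reachable from the initial state. -/
def ReachR (m n : ℕ) (s : ℕ × Finset ℕ) : Prop := ∃ w, evR m n (0, ∅) w = s

theorem ReachR.step {m n : ℕ} {s : ℕ × Finset ℕ} (h : ReachR m n s) (c : AB) :
    ReachR m n (stepR m n s c) := by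
  obtain ⟨w, rfl⟩ := h
  exact ⟨w ++ [c], by simp [evR]⟩

theorem langR_iff (m n : ℕ) (hn : 4 ≤ n) (x : List AB) : ∀ (p : ℕ) (S : Finset ℕ),
    x ∈ langR m n (p, S) ↔ (∃ s ∈ S, x.foldl (stepAC n) s = n - 1) ∨
      ∃ u v, u.foldl (stepAB m) p = m - 1 ∧ v.foldl (stepAC n) 0 = n - 1 ∧ x = u ++ v := by
  induction x with
  | nil =>
    intro p S
    constructor
    · intro h
      exact Or.inl ⟨n - 1, h, rfl⟩
    · rintro (⟨s, hs, h⟩ | ⟨u, v, h1, h2, h3⟩)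
      · simp only [List.foldl_nil] at h
        subst h
        exact hs
      · obtain ⟨rfl, rfl⟩ := List.append_eq_nil_iff.mp h3.symm
        simp only [List.foldl_nil] at h2
        omega
  | cons c x ih =>
    intro p S
    have h0 : stepAC n 0 c = 1 := by cases c <;> simp [stepAC] <;> omega
    have key : (c :: x) ∈ langR m n (p, S) ↔ x ∈ langR m n (stepR m n (p, S) c) := Iff.rfl
    rw [key, stepR, ih]
    constructor
    · rintro (⟨s, hs, h⟩ | ⟨u, v, h1, h2, h3⟩)
      · rcases Finset.mem_union.mp hs with hs | hs
        · obtain ⟨t, ht, rfl⟩ := Finset.mem_image.mp hs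
          exact Or.inl ⟨t, ht, h⟩
        · split_ifs at hs with hp
          · have : s = 1 := by simpa using hs
            subst this
            exact Or.inr ⟨[], c :: x, hp, by simpa [h0] using h, rfl⟩
          · simp at hs
      · exact Or.inr ⟨c :: u, v, h1, h2, by simp [h3]⟩
    · rintro (⟨s, hs, h⟩ | ⟨u, v, h1, h2, h3⟩)
      · exact Or.inl ⟨_, Finset.mem_union_left _ (Finset.mem_image_of_mem _ hs), h⟩
      · cases u with
        | nil =>
          simp only [List.foldl_nil] at h1
          simp only [List.nil_append] at h3
          subst h3
          refine Or.inl ⟨1, Finset.mem_union_right _ (by simp [h1]), ?_⟩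
          simpa [h0] using h2
        | cons d u =>
          simp only [List.cons_append, List.cons.injEq] at h3
          obtain ⟨rfl, h3⟩ := h3
          exact Or.inr ⟨u, v, h1, h2, h3⟩

theorem concat_eq_langR (m n : ℕ) (hn : 4 ≤ n) :
    concat (LmAB m) (LnAC n) = langR m n (0, ∅) := by
  ext x
  rw [langR_iff m n hn]
  constructor
  · rintro ⟨u, v, hu, hv, h⟩
    exact Or.inr ⟨u, v, hu, hv, h⟩
  · rintro (⟨s, hs, _⟩ | ⟨u, v, hu, hv, h⟩)
    · simp at hs
    · exact ⟨u, v, hu, hv, h⟩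

theorem leftQuot_langR (m n : ℕ) (s : ℕ × Finset ℕ) (w : List AB) :
    leftQuot (langR m n s) w = langR m n (evR m n s w) := by
  ext x
  simp [leftQuot, langR, evR]

theorem mem_rot (m n : ℕ) (hn : 4 ≤ n) (k : ℕ) : ∀ (s : ℕ × Finset ℕ) (i : ℕ), 1 ≤ i → i + k = n - 1 →
    (List.replicate k AB.a ∈ langR m n s ↔ i ∈ s.2) := by
  induction k with
  | zero =>
    intro s i h1 h2
    have : i = n - 1 := by omega
    subst this
    exact Iff.rfl
  | succ k ih =>
    intro s i h1 h2
    have key : List.replicate (k + 1) AB.a ∈ langR m n s ↔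
      List.replicate k AB.a ∈ langR m n (stepR m n s AB.a) := Iff.rfl
    rw [key, ih _ (i + 1) (by omega) (by omega)]
    simp only [stepR, stepAC, Finset.mem_union, Finset.mem_image]
    constructor
    · rintro (⟨t, ht, h⟩ | h)
      · have : t = i := by split_ifs at h <;> omega
        exact this ▸ ht
      · split_ifs at h
        · have := Finset.mem_singleton.mp h
          omega
        · simp at h
    · intro h
      exact Or.inl ⟨i, h, by rw [if_neg (by omega)]⟩

theorem fst_rot (m n : ℕ) (k : ℕ) : ∀ (s : ℕ × Finset ℕ) (q : ℕ), s.1 ≤ m - 1 → 1 ≤ q →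
    q + k = m - 1 → ((evR m n s (List.replicate k AB.a)).1 = m - 1 ↔ s.1 = q) := by
  induction k with
  | zero =>
    intro s q h0 h1 h2
    have : q = m - 1 := by omega
    subst this
    exact Iff.rfl
  | succ k ih =>
    intro s q h0 h1 h2
    have key : evR m n s (List.replicate (k + 1) AB.a) =
      evR m n (stepR m n s AB.a) (List.replicate k AB.a) := rfl
    rw [key, ih _ (q + 1) _ (by omega) (by omega)]
    · simp only [stepR, stepAB]
      split_ifs <;> omega
    · simp only [stepR, stepAB]
      split_ifs <;> omega

theorem zero_notMem (m n : ℕ) (w : List AB) : ∀ (s : ℕ × Finset ℕ), 0 ∉ s.2 →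
    0 ∉ (evR m n s w).2 := by
  induction w with
  | nil => intro s h; exact h
  | cons c w ih =>
    intro s h
    have key : evR m n s (c :: w) = evR m n (stepR m n s c) w := rfl
    rw [key]
    apply ih
    simp only [stepR, Finset.mem_union, Finset.mem_image, not_or, not_exists, not_and]
    refine ⟨fun t _ => ?_, ?_⟩
    · have : 1 ≤ stepAC n t c := by cases c <;> simp only [stepAC] <;> split_ifs <;> omega
      omega
    · split_ifs <;> simp

theorem mem_b (m n : ℕ) (s : ℕ × Finset ℕ) (h : 0 ∉ s.2) :
    1 ∈ (stepR m n s AB.b).2 ↔ s.1 = m - 1 := by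
  simp only [stepR, stepAC, Finset.mem_union, Finset.mem_image]
  constructor
  · rintro (⟨t, ht, h'⟩ | h')
    · have : t = 0 := by split_ifs at h' <;> omega
      exact absurd (this ▸ ht) h
    · by_contra hc
      simp [hc] at h'
  · intro h'
    simp [h']

theorem fst_word (m n k q : ℕ) (hn : 4 ≤ n) (s : ℕ × Finset ℕ) (h0 : 0 ∉ s.2) (h1 : s.1 ≤ m - 1)
    (h2 : 1 ≤ q) (h3 : q + k = m - 1) :
    (List.replicate k AB.a ++ AB.b :: List.replicate (n - 2) AB.a ∈ langR m n s ↔ s.1 = q) := by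
  rw [← fst_rot m n k s q h1 h2 h3]
  have key : List.replicate k AB.a ++ AB.b :: List.replicate (n - 2) AB.a ∈ langR m n s ↔
      List.replicate (n - 2) AB.a ∈
        langR m n (stepR m n (evR m n s (List.replicate k AB.a)) AB.b) := by
    simp [langR, evR]
  rw [key, mem_rot m n hn (n - 2) _ 1 le_rfl (by omega), mem_b]
  exact zero_notMem m n _ s h0

/-- The states of the subset automaton that are reached. -/
def allR (m n : ℕ) : Finset (ℕ × Finset ℕ) :=
  insert (0, ∅) (Finset.Icc 1 (m - 1) ×ˢ (Finset.Icc 1 (n - 1)).powerset)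

theorem mem_allR {m n : ℕ} {s : ℕ × Finset ℕ} : s ∈ allR m n ↔ s = (0, ∅) ∨
    ((1 ≤ s.1 ∧ s.1 ≤ m - 1) ∧ s.2 ⊆ Finset.Icc 1 (n - 1)) := by
  simp [allR]

theorem card_allR (m n : ℕ) : (allR m n).card = (m - 1) * 2 ^ (n - 1) + 1 := by
  rw [allR, Finset.card_insert_of_notMem (by simp)]
  simp

theorem langR_inj (m n : ℕ) (hn : 4 ≤ n) : Set.InjOn (langR m n) (allR m n) := by
  have aux : ∀ s ∈ allR m n, s.1 ≤ m - 1 ∧ s.2 ⊆ Finset.Icc 1 (n - 1) := by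
    intro s hs
    rcases mem_allR.mp hs with rfl | h
    · simp
    · exact ⟨h.1.2, h.2⟩
  intro s hs t ht hst
  obtain ⟨hs1, hs2⟩ := aux s hs
  obtain ⟨ht1, ht2⟩ := aux t ht
  have hs0 : 0 ∉ s.2 := fun h => by simpa using hs2 h
  have ht0 : 0 ∉ t.2 := fun h => by simpa using ht2 h
  refine Prod.ext ?_ ?_
  · have h1 : 1 ≤ s.1 → s.1 = t.1 := fun h => by
      have h1 := fst_word m n (m - 1 - s.1) s.1 hn s hs0 hs1 h (by omega)
      have h2 := fst_word m n (m - 1 - s.1) s.1 hn t ht0 ht1 h (by omega)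
      rw [hst] at h1
      exact (h2.mp (h1.mpr rfl)).symm
    have h2 : 1 ≤ t.1 → t.1 = s.1 := fun h => by
      have h1 := fst_word m n (m - 1 - t.1) t.1 hn s hs0 hs1 h (by omega)
      have h2 := fst_word m n (m - 1 - t.1) t.1 hn t ht0 ht1 h (by omega)
      rw [hst] at h1
      exact (h1.mp (h2.mpr rfl)).symm
    omega
  · ext i
    by_cases hi : 1 ≤ i ∧ i ≤ n - 1
    · rw [← mem_rot m n hn (n - 1 - i) s i hi.1 (by omega),
        ← mem_rot m n hn (n - 1 - i) t i hi.1 (by omega), hst]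
    · constructor
      · intro h
        exact absurd (Finset.mem_Icc.mp (hs2 h)) hi
      · intro h
        exact absurd (Finset.mem_Icc.mp (ht2 h)) hi

theorem step_allR {m n : ℕ} (hm : 4 ≤ m) (hn : 4 ≤ n) {s : ℕ × Finset ℕ} (hs : s ∈ allR m n)
    (c : AB) : stepR m n s c ∈ allR m n := by
  have aux : s.1 ≤ m - 1 ∧ s.2 ⊆ Finset.Icc 1 (n - 1) := by
    rcases mem_allR.mp hs with rfl | h
    · simp
    · exact ⟨h.1.2, h.2⟩
  obtain ⟨h1, h2⟩ := aux
  refine mem_allR.mpr (Or.inr ⟨?_, ?_⟩)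
  · cases c <;> simp only [stepR, stepAB] <;> split_ifs <;> omega
  · intro x hx
    simp only [stepR, Finset.mem_union, Finset.mem_image] at hx
    rw [Finset.mem_Icc]
    rcases hx with ⟨t, ht, rfl⟩ | hx
    · have := Finset.mem_Icc.mp (h2 ht)
      cases c <;> simp only [stepAC] <;> split_ifs <;> omega
    · split_ifs at hx
      · have := Finset.mem_singleton.mp hx
        omega
      · simp at hx

theorem reach_allR {m n : ℕ} (hm : 4 ≤ m) (hn : 4 ≤ n) {s : ℕ × Finset ℕ} (h : ReachR m n s) :
    s ∈ allR m n := by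
  obtain ⟨w, rfl⟩ := h
  induction w using List.reverseRecOn with
  | nil => simp [evR, allR]
  | append_singleton w c ih =>
    have : evR m n (0, ∅) (w ++ [c]) = stepR m n (evR m n (0, ∅) w) c := by simp [evR]
    rw [this]
    exact step_allR hm hn ih c

theorem image_inv {T : Finset ℕ} {f g : ℕ → ℕ} (h : ∀ x ∈ T, f (g x) = x) :
    (T.image g).image f = T := by
  rw [Finset.image_image]
  ext y
  simp only [Finset.mem_image, Function.comp]
  constructor
  · rintro ⟨x, hx, rfl⟩
    rwa [h x hx]
  · intro hy
    exact ⟨y, hy, h y hy⟩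

theorem step_back {m n p p' : ℕ} {T : Finset ℕ} (c : AB) (g : ℕ → ℕ) (hp : p ≠ m - 1)
    (hp' : stepAB m p c = p')
    (hg : ∀ x ∈ T, stepAC n (g x) c = x) (h : ReachR m n (p, T.image g)) :
    ReachR m n (p', T) := by
  have := h.step c
  have e : (T.image g).image (fun q => stepAC n q c) = T := image_inv hg
  simpa [stepR, hp, hp', e] using this

/-- Inverse of the rotation by `a`. -/
def rotI (n x : ℕ) : ℕ := if x = 1 then n - 1 else x - 1

/-- Inverse of `b` on `{2, …, n-1}`. -/
def rotB (n x : ℕ) : ℕ := if x = 2 then n - 1 else x - 1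

section reach
variable {m n : ℕ}

theorem image_sub {T : Finset ℕ} {g : ℕ → ℕ}
    (h : ∀ x ∈ T, 1 ≤ g x ∧ g x ≤ n - 1) : T.image g ⊆ Finset.Icc 1 (n - 1) := by
  intro y hy
  obtain ⟨x, hx, rfl⟩ := Finset.mem_image.mp hy
  exact Finset.mem_Icc.mpr (h x hx)

/-- From the states `(1, S)` one reaches all `(p, S)`. -/
theorem reach_up (hn : 4 ≤ n) (k : ℕ)
    (h : ∀ T ⊆ Finset.Icc 1 (n - 1), T.card ≤ k → ReachR m n (1, T)) (j : ℕ) :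
    j + 1 ≤ m - 1 → ∀ T ⊆ Finset.Icc 1 (n - 1), T.card ≤ k → ReachR m n (j + 1, T) := by
  induction j with
  | zero => intro _; exact h
  | succ j ih =>
    intro hj T hT hk
    refine step_back AB.a (rotI n) (p := j + 1) (by omega) ?_ ?_ (ih (by omega) _ ?_ ?_)
    · simp only [stepAB]; rw [if_neg (by omega)]
    · intro x hx
      have := Finset.mem_Icc.mp (hT hx)
      simp only [stepAC, rotI]; split_ifs <;> omega
    · apply image_sub
      intro x hx
      have := Finset.mem_Icc.mp (hT hx)
      simp only [rotI]; split_ifs <;> omega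
    · exact Finset.card_image_le.trans hk

theorem reach_one (hm : 4 ≤ m) (hn : 4 ≤ n) (k : ℕ)
    (h : ∀ T ⊆ Finset.Icc 1 (n - 1), T.card ≤ k → ReachR m n (1, T)) (T : Finset ℕ)
    (hT : T ⊆ Finset.Icc 1 (n - 1)) (hk : T.card ≤ k + 1) (h1 : 1 ∈ T) : ReachR m n (1, T) := by
  have hr : ReachR m n (m - 1, (T.erase 1).image (rotI n)) := by
    have := reach_up hn k h (m - 2) (by omega) ((T.erase 1).image (rotI n)) ?_ ?_
    · have e : m - 2 + 1 = m - 1 := by omega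
      rwa [e] at this
    · apply image_sub
      intro x hx
      have := Finset.mem_Icc.mp (hT (Finset.mem_of_mem_erase hx))
      simp only [rotI]; split_ifs <;> omega
    · refine Finset.card_image_le.trans ?_
      rw [Finset.card_erase_of_mem h1]; omega
  have h2 := hr.step AB.a
  have h3 : ((T.erase 1).image (rotI n)).image (fun q => stepAC n q AB.a) = T.erase 1 := by
    apply image_inv
    intro x hx
    have := Finset.mem_Icc.mp (hT (Finset.mem_of_mem_erase hx))
    simp only [stepAC, rotI]; split_ifs <;> omega
  have h4 : stepR m n (m - 1, (T.erase 1).image (rotI n)) AB.a = (1, T) := by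
    simp only [stepR, h3, stepAB, if_true]
    congr 1
    rw [Finset.union_comm, ← Finset.insert_eq, Finset.insert_erase h1]
  rwa [h4] at h2

/-- Pulling back along `ab`. -/
theorem back_ab (hm : 4 ≤ m) (hn : 4 ≤ n) (T : Finset ℕ) (hT : T ⊆ Finset.Icc 1 (n - 1))
    (h1 : 1 ∉ T) (h : ReachR m n (1, (T.image (fun x => x - 1)).image (rotI n))) :
    ReachR m n (1, T) := by
  have hx1 : ∀ x ∈ T, 2 ≤ x ∧ x ≤ n - 1 := fun x hx => by
    have := Finset.mem_Icc.mp (hT hx)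
    have : x ≠ 1 := fun e => h1 (e ▸ hx)
    omega
  refine step_back AB.b (fun x => x - 1) (p := 2) (by omega) (by simp [stepAB]) ?_ ?_
  · intro x hx
    have := hx1 x hx
    simp only [stepAC]; split_ifs <;> omega
  · refine step_back AB.a (rotI n) (p := 1) (by omega) ?_ ?_ h
    · simp only [stepAB]; rw [if_neg (by omega)]
    · intro y hy
      obtain ⟨x, hx, rfl⟩ := Finset.mem_image.mp hy
      have := hx1 x hx
      simp only [stepAC, rotI]; split_ifs <;> omega

/-- Pulling back along `bb`. -/
theorem back_bb (hm : 4 ≤ m) (hn : 4 ≤ n) (T : Finset ℕ) (hT : T ⊆ Finset.Icc 1 (n - 1))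
    (h1 : 1 ∉ T) (h : ReachR m n (1, (T.image (rotB n)).image (rotB n))) :
    ReachR m n (1, T) := by
  have hx1 : ∀ x ∈ T, 2 ≤ x ∧ x ≤ n - 1 := fun x hx => by
    have := Finset.mem_Icc.mp (hT hx)
    have : x ≠ 1 := fun e => h1 (e ▸ hx)
    omega
  refine step_back AB.b (rotB n) (p := 2) (by omega) (by simp [stepAB]) ?_ ?_
  · intro x hx
    have := hx1 x hx
    simp only [stepAC, rotB]; split_ifs <;> omega
  · refine step_back AB.b (rotB n) (p := 1) (by omega) (by simp [stepAB]) ?_ h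
    · intro y hy
      obtain ⟨x, hx, rfl⟩ := Finset.mem_image.mp hy
      have := hx1 x hx
      simp only [stepAC, rotB]; split_ifs <;> omega

/-- All sets avoiding `1` and containing `t` are reached together with `1'`. -/
def GoodAt (m n k t : ℕ) : Prop := ∀ T ⊆ Finset.Icc 1 (n - 1), T.card ≤ k + 1 → 1 ∉ T → t ∈ T →
  ReachR m n (1, T)

theorem good_bb (hm : 4 ≤ m) (hn : 4 ≤ n) (k t : ℕ) (h : GoodAt m n k (rotB n (rotB n t))) :
    GoodAt m n k t := by
  intro T hT hk h1 ht
  have hx1 : ∀ x ∈ T, 2 ≤ x ∧ x ≤ n - 1 := fun x hx => by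
    have := Finset.mem_Icc.mp (hT hx)
    have : x ≠ 1 := fun e => h1 (e ▸ hx)
    omega
  have hx2 : ∀ x ∈ T, 2 ≤ rotB n (rotB n x) ∧ rotB n (rotB n x) ≤ n - 1 := fun x hx => by
    have := hx1 x hx
    simp only [rotB]; split_ifs <;> omega
  apply back_bb hm hn T hT h1
  apply h
  · rw [Finset.image_image]
    apply image_sub
    intro x hx
    have := hx2 x hx
    simp only [Function.comp]
    omega
  · exact Finset.card_image_le.trans (Finset.card_image_le.trans hk)
  · rw [Finset.image_image, Finset.mem_image]
    rintro ⟨x, hx, e⟩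
    have := hx2 x hx
    simp only [Function.comp] at e
    omega
  · exact Finset.mem_image_of_mem _ (Finset.mem_image_of_mem _ ht)

theorem reach_ab (hm : 4 ≤ m) (hn : 4 ≤ n) (k : ℕ)
    (h : ∀ T ⊆ Finset.Icc 1 (n - 1), T.card ≤ k → ReachR m n (1, T)) (t : ℕ)
    (ht : rotI n (t - 1) = 1 ∨ GoodAt m n k (rotI n (t - 1))) : GoodAt m n k t := by
  intro T hT hk h1 htT
  have hx1 : ∀ x ∈ T, 2 ≤ x ∧ x ≤ n - 1 := fun x hx => by
    have := Finset.mem_Icc.mp (hT hx)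
    have : x ≠ 1 := fun e => h1 (e ▸ hx)
    omega
  apply back_ab hm hn T hT h1
  have hsub : (T.image (fun x => x - 1)).image (rotI n) ⊆ Finset.Icc 1 (n - 1) := by
    rw [Finset.image_image]
    apply image_sub
    intro x hx
    have := hx1 x hx
    simp only [Function.comp, rotI]
    split_ifs <;> omega
  have hcard : ((T.image (fun x => x - 1)).image (rotI n)).card ≤ k + 1 :=
    Finset.card_image_le.trans (Finset.card_image_le.trans hk)
  have hmem : rotI n (t - 1) ∈ (T.image (fun x => x - 1)).image (rotI n) :=
    Finset.mem_image_of_mem _ (Finset.mem_image_of_mem (fun x => x - 1) htT)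
  by_cases hone : 1 ∈ (T.image (fun x => x - 1)).image (rotI n)
  · exact reach_one hm hn k h _ hsub hcard hone
  · rcases ht with ht | ht
    · exact absurd (by rwa [ht] at hmem) hone
    · exact ht _ hsub hcard hone hmem

theorem good_all (hm : 4 ≤ m) (hn : 4 ≤ n) (k : ℕ)
    (h : ∀ T ⊆ Finset.Icc 1 (n - 1), T.card ≤ k → ReachR m n (1, T)) (t : ℕ) (ht : 2 ≤ t) :
    GoodAt m n k t := by
  have up : ∀ t, 2 ≤ t → GoodAt m n k t → GoodAt m n k (t + 2) := by
    intro t ht hg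
    apply good_bb hm hn
    have : rotB n (rotB n (t + 2)) = t := by
      simp only [rotB]; split_ifs <;> omega
    rwa [this]
  have h3 : GoodAt m n k 3 := by
    apply reach_ab hm hn k h
    left
    simp [rotI]
  have hodd : ∀ j, GoodAt m n k (2 * j + 3) := by
    intro j
    induction j with
    | zero => exact h3
    | succ j ih => exact up _ (by omega) ih
  have h2 : GoodAt m n k 2 := by
    rcases Nat.even_or_odd' n with ⟨c, hc | hc⟩
    · apply reach_ab hm hn k h
      right
      have : rotI n (2 - 1) = 2 * (c - 2) + 3 := by simp only [rotI]; split_ifs <;> omega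
      rw [this]
      exact hodd _
    · apply good_bb hm hn
      have : rotB n (rotB n 2) = 2 * (c - 2) + 3 := by simp only [rotB]; split_ifs <;> omega
      rw [this]
      exact hodd _
  have heven : ∀ j, GoodAt m n k (2 * j + 2) := by
    intro j
    induction j with
    | zero => exact h2
    | succ j ih => exact up _ (by omega) ih
  rcases Nat.even_or_odd' t with ⟨c, hc | hc⟩
  · have : t = 2 * (c - 1) + 2 := by omega
    rw [this]; exact heven _
  · have : t = 2 * (c - 1) + 3 := by omega
    rw [this]; exact hodd _

theorem reach_first (hm : 4 ≤ m) (hn : 4 ≤ n) (k : ℕ) :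
    ∀ T ⊆ Finset.Icc 1 (n - 1), T.card ≤ k → ReachR m n (1, T) := by
  have hempty : ReachR m n (1, ∅) := by
    refine ⟨[AB.a], ?_⟩
    have h0 : 0 ≠ m - 1 := by omega
    simp [evR, stepR, stepAB, h0]
  induction k with
  | zero =>
    intro T _ hk
    have : T = ∅ := by simpa using hk
    rw [this]; exact hempty
  | succ k ih =>
    intro T hT hk
    by_cases h1 : 1 ∈ T
    · exact reach_one hm hn k ih T hT hk h1
    · rcases T.eq_empty_or_nonempty with rfl | ⟨t, ht⟩
      · exact hempty
      · have := Finset.mem_Icc.mp (hT ht)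
        have : t ≠ 1 := fun e => h1 (e ▸ ht)
        exact good_all hm hn k ih t (by omega) T hT hk h1 ht

theorem reach_iff (hm : 4 ≤ m) (hn : 4 ≤ n) (s : ℕ × Finset ℕ) :
    ReachR m n s ↔ s ∈ allR m n := by
  refine ⟨reach_allR hm hn, fun h => ?_⟩
  rcases mem_allR.mp h with rfl | ⟨⟨h1, h2⟩, h3⟩
  · exact ⟨[], rfl⟩
  · obtain ⟨p, S⟩ := s
    have := reach_up hn S.card (reach_first hm hn S.card) (p - 1) (by simp only at h1 h2; omega)
      S h3 le_rfl
    have e : p - 1 + 1 = p := by simp only at h1; omega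
    rwa [e] at this

end reach

/-- The product `L'_m(a,b) · L_n(a,-,b)` has state complexity `(m-1)·2^{n-1} + 1`. -/
theorem stmt14 (m n : ℕ) (hm : 4 ≤ m) (hn : 4 ≤ n) :
    stateComplexity (concat (LmAB m) (LnAC n)) = (m - 1) * 2 ^ (n - 1) + 1 := by
  have hq : quotients (concat (LmAB m) (LnAC n)) = langR m n '' (allR m n : Set _) := by
    rw [concat_eq_langR m n hn]
    ext L
    simp only [quotients, Set.mem_range, Set.mem_image, Finset.mem_coe, leftQuot_langR]
    constructor
    · rintro ⟨w, rfl⟩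
      exact ⟨_, (reach_iff hm hn _).mp ⟨w, rfl⟩, rfl⟩
    · rintro ⟨s, hs, rfl⟩
      obtain ⟨w, hw⟩ := (reach_iff hm hn s).mpr hs
      exact ⟨w, by rw [hw]⟩
  rw [stateComplexity, hq, Nat.card_coe_set_eq, Set.ncard_image_of_injOn (langR_inj m n hn),
    Set.ncard_coe_finset, card_allR]
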